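/- Let ε ∈ (0,1/2) and F ∈ (0,1] satisfy F² > ε/(1−ε), and set ε_n := εⁿ/(εⁿ + (1−ε)ⁿ). Then ε_n → 0 as n → ∞, and moreover h(ε_n)/F^{2n} → 0 as n → ∞; in particular, for every constant c > 0 there exists N such that h(ε_n) < c·F^{2n} for all n ≥ N. -/

import Mathlib

noncomputable section

/-- Binary entropy function. -/
def binEnt (p : ℝ) : ℝ := -(p * Real.logb 2 p) - (1 - p) * Real.logb 2 (1 - p)

/-- The base-2 entropy is the natural-logarithm entropy divided by `log 2`. -/
theorem binEnt_eq_binEntropy_div_log_two (p : ℝ) :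
    binEnt p = Real.binEntropy p / Real.log 2 := by
  simp only [binEnt, Real.logb, Real.binEntropy, Real.log_inv]
  ring

theorem binEnt_nonneg {p : ℝ} (hp₀ : 0 ≤ p) (hp₁ : p ≤ 1) : 0 ≤ binEnt p := by
  rw [binEnt_eq_binEntropy_div_log_two]
  exact div_nonneg (Real.binEntropy_nonneg hp₀ hp₁) (Real.log_nonneg one_le_two)

/-- Entropy bound for a probability given by its odds `x`. -/
theorem binEntropy_div_one_add_le {x : ℝ} (hx₀ : 0 < x) (hx₁ : x ≤ 1) :
    Real.binEntropy (x / (1 + x)) ≤ x * (1 - Real.log x) := by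
  have hx : 0 < 1 + x := by linarith
  have hsub : 1 - x / (1 + x) = 1 / (1 + x) := by field_simp; ring
  have heq : Real.binEntropy (x / (1 + x)) =
      Real.log (1 + x) + x / (1 + x) * -Real.log x := by
    rw [Real.binEntropy, hsub, Real.log_inv, Real.log_inv, Real.log_div hx₀.ne' hx.ne',
      Real.log_div one_ne_zero hx.ne', Real.log_one]
    field_simp
    ring
  have hlog : Real.log (1 + x) ≤ x := by linarith [Real.log_le_sub_one_of_pos hx]
  have hmul : x / (1 + x) * -Real.log x ≤ x * -Real.log x :=
    mul_le_mul_of_nonneg_right (div_le_self hx₀.le (by linarith))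
      (neg_nonneg.2 (Real.log_nonpos hx₀.le hx₁))
  rw [heq]
  linarith

/-- The entropy of probabilities with geometric odds `r ^ n` decays faster than `s ^ n`,
for every `s > r`. -/
theorem tendsto_binEnt_geometric_odds_div_pow {r s : ℝ} (hr₀ : 0 < r) (hr₁ : r ≤ 1)
    (hrs : r < s) :
    Filter.Tendsto (fun n : ℕ => binEnt (r ^ n / (1 + r ^ n)) / s ^ n)
      Filter.atTop (nhds 0) := by
  have hs : 0 < s := hr₀.trans hrs
  have hq₀ : 0 ≤ r / s := by positivity
  have hq₁ : r / s < 1 := (div_lt_one hs).2 hrs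
  have hbound : Filter.Tendsto
      (fun n : ℕ => ((r / s) ^ n - Real.log r * (n * (r / s) ^ n)) / Real.log 2)
      Filter.atTop (nhds 0) := by
    simpa using ((tendsto_pow_atTop_nhds_zero_of_lt_one hq₀ hq₁).sub
      ((tendsto_self_mul_const_pow_of_lt_one hq₀ hq₁).const_mul (Real.log r))).div_const
        (Real.log 2)
  refine squeeze_zero (fun n => ?_) (fun n => ?_) hbound
  · have hx : 0 < r ^ n := pow_pos hr₀ n
    exact div_nonneg (binEnt_nonneg (by positivity) ((div_le_one (by linarith)).2 (by linarith)))
      (pow_pos hs n).le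
  · have hle := binEntropy_div_one_add_le (pow_pos hr₀ n) (pow_le_one₀ hr₀.le hr₁)
    rw [Real.log_pow] at hle
    calc binEnt (r ^ n / (1 + r ^ n)) / s ^ n
        ≤ r ^ n * (1 - n * Real.log r) / Real.log 2 / s ^ n := by
          rw [binEnt_eq_binEntropy_div_log_two]
          have := Real.log_pos one_lt_two
          gcongr
      _ = ((r / s) ^ n - Real.log r * (n * (r / s) ^ n)) / Real.log 2 := by
          rw [div_pow]
          ring

/-- Let `ε ∈ (0,1/2)` and `F ∈ (0,1]` satisfy `F² > ε/(1-ε)`, and set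
`εₙ := εⁿ/(εⁿ + (1-ε)ⁿ)`. Then `εₙ → 0`, and `h(εₙ)/F^(2n) → 0` as `n → ∞`; in
particular, for every `c > 0` there exists `N` such that `h(εₙ) < c·F^(2n)` for all
`n ≥ N`. -/
theorem binary_entropy_beats_fidelity_power
    (ε F : ℝ) (hε : ε ∈ Set.Ioo (0 : ℝ) (1 / 2)) (hF : F ∈ Set.Ioc (0 : ℝ) 1)
    (h : F ^ 2 > ε / (1 - ε)) :
    Filter.Tendsto (fun n : ℕ => ε ^ n / (ε ^ n + (1 - ε) ^ n))
      Filter.atTop (nhds 0) ∧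
    Filter.Tendsto (fun n : ℕ => binEnt (ε ^ n / (ε ^ n + (1 - ε) ^ n)) / F ^ (2 * n))
      Filter.atTop (nhds 0) ∧
    ∀ c : ℝ, 0 < c → ∃ N : ℕ, ∀ n ≥ N,
      binEnt (ε ^ n / (ε ^ n + (1 - ε) ^ n)) < c * F ^ (2 * n) := by
  obtain ⟨hε₀, hε₁⟩ := hε
  have hε' : 0 < 1 - ε := by linarith
  set r := ε / (1 - ε) with hr
  have hr₀ : 0 < r := div_pos hε₀ hε'
  have hr₁ : r < 1 := (div_lt_one hε').2 (by linarith)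
  have hodds (n : ℕ) : ε ^ n / (ε ^ n + (1 - ε) ^ n) = r ^ n / (1 + r ^ n) := by
    have h₁ : 0 < ε ^ n := pow_pos hε₀ n
    have h₂ : 0 < (1 - ε) ^ n := pow_pos hε' n
    rw [hr, div_pow]
    field_simp
    ring
  have hlim := tendsto_binEnt_geometric_odds_div_pow hr₀ hr₁.le h
  simp only [hodds, pow_mul]
  refine ⟨?_, hlim, fun c hc => ?_⟩
  · have hpow := tendsto_pow_atTop_nhds_zero_of_lt_one hr₀.le hr₁
    simpa [Pi.div_def] using hpow.div (hpow.const_add 1) (by norm_num)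
  · obtain ⟨N, hN⟩ := Filter.eventually_atTop.1 (hlim.eventually_lt_const hc)
    exact ⟨N, fun n hn => (div_lt_iff₀ (pow_pos (hr₀.trans h) n)).1 (hN n hn)⟩

end
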